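/- Let S be a commutative semilocal ring (a commutative ring with only finitely many maximal ideals) and let n ≥ 1. Let M be an invertible (2n) × (2n) matrix over S which is alternating, i.e., Mᵀ = −M and every diagonal entry of M is zero. Then M is congruent to the standard symplectic matrix J: there exists an invertible (2n) × (2n) matrix P over S such that Pᵀ · M · P = J, where J is the block matrix with blocks [[0, −I_n], [I_n, 0]]. -/

import Mathlib

open Matrix

open Module in
/-- A module over a semilocal ring which becomes free of rank `m + k` after adding a free module
of rank `k` is free of rank `m`. -/
theorem nonempty_basis_of_prod_free {S W F V : Type*} [CommRing S] [Finite (MaximalSpectrum S)]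
    [AddCommGroup W] [Module S W] [AddCommGroup F] [Module S F] [AddCommGroup V] [Module S V]
    {ι κ : Type*} [Fintype ι] [Fintype κ]
    (bV : Basis ι S V) (bF : Basis κ S F)
    (e : (W × F) ≃ₗ[S] V) {m : ℕ} (hm : Fintype.card ι = m + Fintype.card κ) :
    Nonempty (Basis (Fin m) S W) := by
  have : Module.Free S F := .of_basis bF
  have : Module.Finite S F := .of_basis bF
  have : Module.Free S V := .of_basis bV
  have : Module.Finite S V := .of_basis bV
  have : Module.Finite S (W × F) := .equiv e.symm
  have : Module.Projective S (W × F) := .of_equiv e.symm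
  have : Module.Finite S W := .of_surjective (LinearMap.fst S W F) LinearMap.fst_surjective
  have : Module.Projective S W :=
    .of_split (LinearMap.inl S W F) (LinearMap.fst S W F) (by ext; simp)
  refine nonempty_basis_of_flat_of_finrank_eq S W m fun P ↦ ?_
  let := Ideal.Quotient.field P.1
  let E := (TensorProduct.prodRight S (S ⧸ P.1) (S ⧸ P.1) W F).symm ≪≫ₗ
    e.baseChange S (S ⧸ P.1) _ _
  have h := E.finrank_eq
  rw [finrank_prod, finrank_eq_card_basis (bV.baseChange (S ⧸ P.1)),
    finrank_eq_card_basis (bF.baseChange (S ⧸ P.1))] at h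
  omega

namespace LinearMap.IsAlt

variable {S V : Type*} [CommRing S] [AddCommGroup V] [Module S V] {B : V →ₗ[S] V →ₗ[S] S}

/-- The decomposition of a space with an alternating form as the orthogonal sum of the complement
of a hyperbolic pair and the hyperbolic plane it spans. -/
def hyperbolicDecomposition (hB : B.IsAlt) {e f : V} (hfe : B f e = 1) :
    ((ker (B e) ⊓ ker (B f) : Submodule S V) × ((Fin 1 → S) × (Fin 1 → S))) ≃ₗ[S] V :=
  have hef : B e f = -1 := by rw [← hB.neg, hfe]
  have hee : B e e = 0 := hB e
  have hff : B f f = 0 := hB f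
  { toFun x := x.1 + (x.2.1 0 • e + x.2.2 0 • f)
    map_add' x y := by simp; module
    map_smul' a x := by simp; module
    invFun v := (⟨v - B f v • e + B e v • f, by simp [hfe, hef, hee, hff]⟩,
      (fun _ ↦ B f v, fun _ ↦ - B e v))
    left_inv := by
      rintro ⟨⟨w, hw⟩, x, y⟩
      obtain ⟨h1, h2⟩ : B e w = 0 ∧ B f w = 0 := by simpa using hw
      ext i
      · simp [hfe, hef, hee, hff, h1, h2]
        abel
      · simp [hfe, hff, h2, Subsingleton.elim i 0]
      · simp [hef, hee, h1, Subsingleton.elim i 0]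
    right_inv v := by simp; abel }

/-- Over a semilocal ring, a free module of rank `2n` with an alternating form inducing a
surjection onto the dual has a symplectic basis. -/
theorem exists_basis_toMatrix₂_eq_J [Finite (MaximalSpectrum S)] {n : ℕ}
    (b₀ : Module.Basis (Fin n ⊕ Fin n) S V) (hB : B.IsAlt) (hs : Function.Surjective B) :
    ∃ b : Module.Basis (Fin n ⊕ Fin n) S V, LinearMap.toMatrix₂ b b B = Matrix.J (Fin n) S := by
  induction n generalizing V with
  | zero => exact ⟨b₀, by ext i; exact i.elim Fin.elim0 Fin.elim0⟩
  | succ n ih =>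
    let e := b₀ (.inl 0)
    obtain ⟨f, hf⟩ := hs (b₀.coord (.inl 0))
    have hfe : B f e = 1 := by simp [hf, e]
    have hef : B e f = -1 := by rw [← hB.neg, hfe]
    let W : Submodule S V := ker (B e) ⊓ ker (B f)
    let D : (W × ((Fin 1 → S) × (Fin 1 → S))) ≃ₗ[S] V := hB.hyperbolicDecomposition hfe
    let bF := (Pi.basisFun S (Fin 1)).prod (Pi.basisFun S (Fin 1))
    obtain ⟨bW⟩ := nonempty_basis_of_prod_free b₀ bF D (m := n + n) (by simp; omega)
    have hW (w : W) : B e w = 0 ∧ B f w = 0 := by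
      simpa only [W, Submodule.mem_inf, LinearMap.mem_ker] using w.2
    have hW' (w : W) : B w e = 0 ∧ B w f = 0 := by
      simp [← hB.neg e w, ← hB.neg f w, hW w]
    obtain ⟨c, hc⟩ := ih (V := W) (B := B.domRestrict₁₂ W W)
      (bW.reindex finSumFinEquiv.symm) (fun w ↦ hB w) fun φ ↦ by
        obtain ⟨v, hv⟩ := hs (φ ∘ₗ LinearMap.fst S W _ ∘ₗ D.symm.toLinearMap)
        refine ⟨(D.symm v).1, LinearMap.ext fun w ↦ ?_⟩
        have hw : D (w, 0) = w := by simp [D, hyperbolicDecomposition]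
        have h : B v w = φ w := by rw [hv, ← hw]; simp
        rw [← h]
        conv_rhs => rw [← D.apply_symm_apply v]
        simp [D, hyperbolicDecomposition, hW w, LinearMap.domRestrict₁₂_apply]
    let E := (Equiv.sumSumSumComm (Fin n) (Fin n) (Fin 1) (Fin 1)).trans
      (finSumFinEquiv.sumCongr finSumFinEquiv)
    refine ⟨((c.prod bF).map D).reindex E, ?_⟩
    have hc' (i j) : B (c i) (c j) = Matrix.J (Fin n) S i j := by
      simp [← hc, LinearMap.toMatrix₂_apply, LinearMap.domRestrict₁₂_apply]
    ext i j
    obtain ⟨i, rfl⟩ := E.surjective i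
    obtain ⟨j, rfl⟩ := E.surjective j
    have hb₁ (i) : D ((c.prod bF) (.inl i)) = c i := by simp [D, hyperbolicDecomposition]
    have hb₂ (i) : D ((c.prod bF) (.inr (.inl i))) = e := by
      simp [D, hyperbolicDecomposition, bF, Subsingleton.elim i 0]
    have hb₃ (i) : D ((c.prod bF) (.inr (.inr i))) = f := by
      simp [D, hyperbolicDecomposition, bF, Subsingleton.elim i 0]
    rw [LinearMap.toMatrix₂_apply]
    simp only [Module.Basis.reindex_apply, Module.Basis.map_apply, Equiv.symm_apply_apply]
    rcases i with (i | i) | (i | i) <;> rcases j with (j | j) | (j | j) <;>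
      simp only [hb₁, hb₂, hb₃, hW, hW', hef, hfe, hB e, hB f, hc'] <;>
      simp [E, Matrix.J, Matrix.one_apply, Fin.ext_iff, Subsingleton.elim _ (0 : Fin 1)]
    all_goals omega

end LinearMap.IsAlt

namespace Matrix

variable {S ι : Type*} [CommRing S] [Fintype ι] [DecidableEq ι] {M : Matrix ι ι S}

theorem isAlt_toLinearMap₂' (halt : Mᵀ = -M) (hdiag : ∀ i, M i i = 0) :
    (Matrix.toLinearMap₂' S M : (ι → S) →ₗ[S] (ι → S) →ₗ[S] S).IsAlt := by
  intro x
  have hM (i j) : M j i = -M i j := congr_fun₂ halt i j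
  simp only [Matrix.toLinearMap₂'_apply, smul_eq_mul, ← Fintype.sum_prod_type']
  refine Finset.sum_involution (fun p _ ↦ p.swap) (fun p _ ↦ ?_) (fun p _ hp h ↦ hp ?_)
    (fun _ _ ↦ Finset.mem_univ _) (fun p _ ↦ p.swap_swap)
  · simp only [Prod.fst_swap, Prod.snd_swap, hM p.1 p.2]
    ring
  · have h' : p.2 = p.1 := congr_arg Prod.fst h
    simp [h', hdiag]

theorem surjective_toLinearMap₂' (hM : IsUnit M) :
    Function.Surjective (Matrix.toLinearMap₂' S M : (ι → S) →ₗ[S] (ι → S) →ₗ[S] S) := by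
  obtain ⟨N, hN⟩ := hM.exists_left_inv
  intro φ
  refine ⟨(fun i ↦ φ (Pi.single i 1)) ᵥ* N, LinearMap.pi_ext' fun i ↦ LinearMap.ext_ring ?_⟩
  rw [LinearMap.comp_apply, LinearMap.comp_apply, Matrix.toLinearMap₂'_apply',
    Matrix.dotProduct_mulVec, Matrix.vecMul_vecMul, hN]
  simp

end Matrix

/-- Over a commutative semilocal ring `S` (a commutative ring with only finitely many
maximal ideals), every invertible alternating `2n × 2n` matrix `M` (i.e. `Mᵀ = -M` and
all diagonal entries of `M` vanish) is congruent to the standard symplectic matrix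
`J = [[0, -I_n], [I_n, 0]]`: there is an invertible matrix `P` with `Pᵀ * M * P = J`. -/
theorem alternating_matrix_congruent_symplectic
    (S : Type*) [CommRing S]
    (hsemilocal : {I : Ideal S | I.IsMaximal}.Finite)
    (n : ℕ) (hn : 1 ≤ n)
    (M : Matrix (Fin n ⊕ Fin n) (Fin n ⊕ Fin n) S)
    (hM : IsUnit M)
    (halt : Mᵀ = -M) (hdiag : ∀ i, M i i = 0) :
    ∃ P : Matrix (Fin n ⊕ Fin n) (Fin n ⊕ Fin n) S,
      IsUnit P ∧ Pᵀ * M * P = Matrix.J (Fin n) S := by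
  have : Finite (MaximalSpectrum S) :=
    (MaximalSpectrum.equivSubtype S).finite_iff.mpr hsemilocal.to_subtype
  let B : (Fin n ⊕ Fin n → S) →ₗ[S] (Fin n ⊕ Fin n → S) →ₗ[S] S := Matrix.toLinearMap₂' S M
  have hB : B.IsAlt := Matrix.isAlt_toLinearMap₂' halt hdiag
  have hs : Function.Surjective B := Matrix.surjective_toLinearMap₂' hM
  obtain ⟨b, hb⟩ := hB.exists_basis_toMatrix₂_eq_J (Pi.basisFun S _) hs
  let := (Pi.basisFun S (Fin n ⊕ Fin n)).invertibleToMatrix b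
  refine ⟨(Pi.basisFun S _).toMatrix b, isUnit_of_invertible _, ?_⟩
  rw [← hb, ← LinearMap.toMatrix₂_mul_basis_toMatrix (Pi.basisFun S _) (Pi.basisFun S _),
    LinearMap.toMatrix₂_basisFun, LinearMap.toMatrix'_toLinearMap₂']
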